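/- arXiv:2412.13101 — 2 statements merged into one kernel-verified Lean document; each statement's English description precedes it below -/
import Mathlib

section
/- Let d ∈ ℕ and let J : ℝ^d → ℝ be continuously differentiable with globally Lipschitz gradient ∇J on a compact set K ⊆ ℝ^d. On a probability space with a filtration (F_k)_{k∈ℕ}, let (x_k) be adapted iterates defined by x_{k+1} = x_k + α_k g_k, where each g_k is F_{k+1}-measurable, E[g_k | F_k] = ∇J(x_k) + δ_k with deterministic bias bounds ‖δ_k‖ ≤ b_k satisfying b_k → 0, and E[‖g_k‖² | F_k] ≤ B almost surely for a constant B > 0. Assume the step sizes satisfy α_k ≥ 0, Σ_k α_k = ∞ and Σ_k α_k² < ∞, that almost surely x_k ∈ K for all k, and that the stationary points of J (points where ∇J vanishes) in K are isolated. Then almost surely the sequence (x_k) converges to a (random) limit x† satisfying ∇J(x†) = 0. -/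
open MeasureTheory Filter Topology

lemma rm_integral_mul_zero {Ω : Type*} {m m0 : MeasurableSpace Ω} {μ : Measure Ω}
    [IsProbabilityMeasure μ] (hm : m ≤ m0) (Z D : Ω → ℝ) (hZ : StronglyMeasurable[m] Z)
    (C : ℝ) (hZb : ∀ᵐ ω ∂μ, |Z ω| ≤ C) (hD : Integrable D μ) (hD0 : μ[D | m] =ᵐ[μ] 0) :
    ∫ ω, Z ω * D ω ∂μ = 0 := by
  have hint : Integrable (Z * D) μ :=
    hD.bdd_mul (hZ.mono hm).aestronglyMeasurable (by simpa using hZb)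
  have h := condExp_mul_of_stronglyMeasurable_left hZ hint hD
  have h2 : ∫ ω, (Z * D) ω ∂μ = 0 := by
    rw [← integral_condExp hm]
    rw [integral_congr_ae (g := fun _ => (0:ℝ))]
    · simp
    · filter_upwards [h, hD0] with ω h1 h2
      rw [h1]; simp [h2]
  simpa using h2

lemma rm_scalar {Ω : Type*} {m0 : MeasurableSpace Ω} {μ : Measure Ω} [IsProbabilityMeasure μ]
    (ℱ : Filtration ℕ m0) (Y : ℕ → Ω → ℝ) (hY : ∀ k, StronglyMeasurable[ℱ (k + 1)] (Y k))
    (C : NNReal) (hC : ∀ k, ∀ᵐ ω ∂μ, |Y k ω| ≤ C) (s : ℕ → ℝ) (hs : Summable s)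
    (hYs : ∀ k, ∫ ω, (Y k ω) ^ 2 ∂μ ≤ s k) :
    ∀ᵐ ω ∂μ, ∃ c, Tendsto (fun n => ∑ k ∈ Finset.range n, (Y k ω - (μ[Y k | ℱ k]) ω))
      atTop (𝓝 c) := by
  have hs0 : ∀ k, 0 ≤ s k := fun k => (integral_nonneg fun ω => sq_nonneg _).trans (hYs k)
  let Q : ℕ → Ω → ℝ := fun k => μ[Y k | ℱ k]
  let D : ℕ → Ω → ℝ := fun k ω => Y k ω - Q k ω
  let M : ℕ → Ω → ℝ := fun n ω => ∑ k ∈ Finset.range n, D k ω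
  have hQm : ∀ k, StronglyMeasurable[ℱ k] (Q k) := fun k => stronglyMeasurable_condExp
  have hQb : ∀ k, ∀ᵐ ω ∂μ, |Q k ω| ≤ C := fun k => ae_bdd_abs_condExp_of_ae_bdd_abs (hC k)
  have hYm : ∀ k, AEStronglyMeasurable (Y k) μ := fun k =>
    ((hY k).mono (ℱ.le _)).aestronglyMeasurable
  have hYi : ∀ k, Integrable (Y k) μ := fun k =>
    Integrable.of_bound (hYm k) C (by simpa using hC k)
  have hQi : ∀ k, Integrable (Q k) μ := fun k => integrable_condExp
  have hDi : ∀ k, Integrable (D k) μ := fun k => (hYi k).sub (hQi k)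
  have hDm : ∀ k, StronglyMeasurable[ℱ (k+1)] (D k) := fun k =>
    (hY k).sub ((hQm k).mono (ℱ.mono (Nat.le_succ k)))
  have hD0 : ∀ k, μ[D k | ℱ k] =ᵐ[μ] 0 := by
    intro k
    have h1 := condExp_sub (hYi k) (hQi k) (ℱ k)
    have h2 : μ[Q k | ℱ k] = Q k := condExp_of_stronglyMeasurable (ℱ.le k) (hQm k) (hQi k)
    have h3 : D k = Y k - Q k := rfl
    rw [h3]
    refine h1.trans ?_
    rw [h2]
    simp [Q]
  have hDb : ∀ k, ∀ᵐ ω ∂μ, |D k ω| ≤ 2 * C := by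
    intro k
    filter_upwards [hC k, hQb k] with ω h1 h2
    have := abs_sub (Y k ω) (Q k ω)
    simp only [D]
    linarith
  have hMm : ∀ n, StronglyMeasurable[ℱ n] (M n) := by
    intro n
    refine Finset.stronglyMeasurable_fun_sum _ fun k hk => ?_
    exact (hDm k).mono (ℱ.mono (Finset.mem_range.1 hk))
  have hMb : ∀ n, ∀ᵐ ω ∂μ, |M n ω| ≤ n * (2 * C) := by
    intro n
    filter_upwards [ae_all_iff.2 hDb] with ω h1
    refine (Finset.abs_sum_le_sum_abs _ _).trans ((Finset.sum_le_sum fun k _ => h1 k).trans ?_)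
    simp
  have hMi : ∀ n, Integrable (M n) μ := fun n => integrable_finsetSum _ fun k _ => hDi k
  have hMs : ∀ n, M (n+1) - M n = D n := by
    intro n; ext ω; simp [M, Finset.sum_range_succ]
  have hMart : Martingale M ℱ μ := by
    refine martingale_of_condExp_sub_eq_zero_nat hMm hMi fun i => ?_
    rw [hMs]; exact hD0 i
  have sqi : ∀ (f : Ω → ℝ) (c : ℝ), AEStronglyMeasurable f μ → (∀ᵐ ω ∂μ, |f ω| ≤ c) →
      Integrable (fun ω => f ω ^ 2) μ := by
    intro f c hf hc
    refine Integrable.of_bound (hf.pow 2) (c^2) ?_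
    filter_upwards [hc] with ω h
    simp only [norm_pow, Real.norm_eq_abs]
    gcongr
  have hDs : ∀ k, ∫ ω, (D k ω) ^ 2 ∂μ ≤ s k := by
    intro k
    have h0 := rm_integral_mul_zero (ℱ.le k) (Q k) (D k) (hQm k) C (hQb k) (hDi k) (hD0 k)
    have hi : Integrable (fun ω => Q k ω * D k ω) μ :=
      (hDi k).bdd_mul ((hQm k).mono (ℱ.le k)).aestronglyMeasurable (by simpa using hQb k)
    have h1 : ∫ ω, (D k ω) ^ 2 ∂μ + 2 * ∫ ω, Q k ω * D k ω ∂μ ≤ ∫ ω, (Y k ω)^2 ∂μ := by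
      rw [← integral_const_mul, ← integral_add (sqi _ _ (hDi k).1 (hDb k)) (hi.const_mul 2)]
      refine integral_mono ((sqi _ _ (hDi k).1 (hDb k)).add (hi.const_mul 2))
        (sqi _ _ (hYm k) (hC k)) fun ω => ?_
      simp only [D]
      nlinarith [sq_nonneg (Q k ω)]
    linarith [hYs k]
  have hM2 : ∀ n, ∫ ω, (M n ω) ^ 2 ∂μ ≤ ∑ k ∈ Finset.range n, s k := by
    intro n
    induction n with
    | zero => simp [M]
    | succ n ih =>
      have h0 := rm_integral_mul_zero (ℱ.le n) (M n) (D n) (hMm n) _ (hMb n) (hDi n) (hD0 n)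
      have hi : Integrable (fun ω => M n ω * D n ω) μ :=
        (hDi n).bdd_mul ((hMm n).mono (ℱ.le n)).aestronglyMeasurable (by simpa using hMb n)
      have h1 : ∫ ω, (M (n+1) ω) ^ 2 ∂μ = ∫ ω, (M n ω) ^ 2 ∂μ + ∫ ω, (D n ω) ^ 2 ∂μ
          + 2 * ∫ ω, M n ω * D n ω ∂μ := by
        have a1 := sqi _ _ (hMi n).1 (hMb n)
        have a2 := sqi _ _ (hDi n).1 (hDb n)
        have a3 : Integrable (fun ω => (M n ω)^2 + (D n ω)^2) μ := a1.add a2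
        rw [← integral_const_mul, ← integral_add a1 a2, ← integral_add a3 (hi.const_mul 2)]
        refine integral_congr_ae (Eventually.of_forall fun ω => ?_)
        simp only [M, Finset.sum_range_succ]
        ring
      rw [Finset.sum_range_succ]
      linarith [hDs n]
  have hb : ∀ n, eLpNorm (M n) 1 μ ≤ ((1 + ∑' k, s k).toNNReal : NNReal) := by
    intro n
    rw [eLpNorm_one_eq_lintegral_enorm, ← ofReal_integral_norm_eq_lintegral_enorm (hMi n)]
    apply ENNReal.ofReal_le_ofReal
    have a1 := sqi _ _ (hMi n).1 (hMb n)
    calc ∫ ω, ‖M n ω‖ ∂μ ≤ ∫ ω, (1 + (M n ω)^2) ∂μ := by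
          refine integral_mono (hMi n).norm ((integrable_const 1).add a1) fun ω => ?_
          simp only [Real.norm_eq_abs]
          nlinarith [sq_abs (M n ω), sq_nonneg (|M n ω| - 1), abs_nonneg (M n ω)]
      _ = 1 + ∫ ω, (M n ω)^2 ∂μ := by
          rw [integral_add (integrable_const 1) a1]; simp
      _ ≤ _ := by
          gcongr
          exact (hM2 n).trans (hs.sum_le_tsum _ fun k _ => hs0 k)
  exact hMart.submartingale.exists_ae_tendsto_of_bdd hb

lemma rm_uc {E G : Type*} [NormedAddCommGroup E] [NormedAddCommGroup G] (h : E → G)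
    (hc : Continuous h) (D : Set E) (hD : IsCompact D) (z x : ℕ → E) (hz : ∀ k, z k ∈ D)
    (hx : ∀ k, x k ∈ D) (hzx : Tendsto (fun k => z k - x k) atTop (𝓝 0)) :
    Tendsto (fun k => h (z k) - h (x k)) atTop (𝓝 0) := by
  have hu := hD.uniformContinuousOn_of_continuous hc.continuousOn
  rw [Metric.uniformContinuousOn_iff] at hu
  rw [Metric.tendsto_atTop] at hzx ⊢
  intro ε hε
  obtain ⟨δ, hδ, H⟩ := hu ε hε
  obtain ⟨N, hN⟩ := hzx δ hδ
  refine ⟨N, fun n hn => ?_⟩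
  have h1 := hN n hn
  rw [dist_zero_right, ← dist_eq_norm] at h1 ⊢
  exact H _ (hz n) _ (hx n) h1

lemma rm_cluster {E : Type*} [NormedAddCommGroup E] (z x : ℕ → E) (p : E)
    (hzx : Tendsto (fun k => z k - x k) atTop (𝓝 0)) (hp : MapClusterPt p atTop x) :
    MapClusterPt p atTop z := by
  rw [Metric.nhds_basis_ball.mapClusterPt_iff_frequently] at hp ⊢
  intro ε hε
  have h1 := hp (ε/2) (by positivity)
  have h2 : ∀ᶠ k in atTop, dist (z k - x k) 0 < ε/2 := hzx.eventually (Metric.ball_mem_nhds _ (by positivity))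
  refine (h1.and_eventually h2).mono ?_
  rintro k ⟨h1, h2⟩
  rw [dist_zero_right, ← dist_eq_norm] at h2
  rw [Metric.mem_ball] at h1 ⊢
  linarith [dist_triangle (z k) (x k) p]

lemma rm_taylor {d : ℕ} (J : EuclideanSpace ℝ (Fin d) → ℝ) (hJ : ContDiff ℝ 1 J)
    (R ε : ℝ) (hε : 0 < ε) : ∃ η > 0, ∀ a ∈ Metric.closedBall (0 : EuclideanSpace ℝ (Fin d)) R,
      ∀ c ∈ Metric.closedBall (0 : EuclideanSpace ℝ (Fin d)) R, dist c a < η →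
      |J c - J a - inner ℝ (gradient J a) (c - a)| ≤ ε * ‖c - a‖ := by
  have hu := (isCompact_closedBall (0 : EuclideanSpace ℝ (Fin d)) R).uniformContinuousOn_of_continuous
    (hJ.continuous_fderiv one_ne_zero).continuousOn
  rw [Metric.uniformContinuousOn_iff] at hu
  obtain ⟨η, hη, H⟩ := hu ε hε
  refine ⟨η, hη, fun a ha c hc hac => ?_⟩
  have hconv : Convex ℝ (Metric.closedBall (0 : EuclideanSpace ℝ (Fin d)) R ∩ Metric.ball a η) :=
    (convex_closedBall _ _).inter (convex_ball _ _)
  have := hconv.norm_image_sub_le_of_norm_fderiv_le' (𝕜 := ℝ) (f := J) (φ := fderiv ℝ J a) (C := ε)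
    (x := a) (y := c)
    (fun y _ => (hJ.differentiable one_ne_zero) y)
    (fun y hy => by
      rw [← dist_eq_norm]
      exact (H y hy.1 a ha hy.2).le) ⟨ha, Metric.mem_ball_self hη⟩ ⟨hc, hac⟩
  have hi : inner ℝ (gradient J a) (c - a) = fderiv ℝ J a (c - a) := by
    simp [gradient]
  rw [hi]
  exact this

lemma rm_det {d : ℕ} (J : EuclideanSpace ℝ (Fin d) → ℝ)
    (K : Set (EuclideanSpace ℝ (Fin d))) (hK : IsCompact K) (hJ : ContDiff ℝ 1 J)
    (hiso : ∀ p ∈ K, gradient J p = 0 →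
      ∃ ε > 0, ∀ q ∈ K, gradient J q = 0 → dist q p < ε → q = p)
    (x z u : ℕ → EuclideanSpace ℝ (Fin d)) (α : ℕ → ℝ) (hα : ∀ k, 0 ≤ α k)
    (hαt : Tendsto α atTop (𝓝 0))
    (hαdiv : Tendsto (fun n => ∑ k ∈ Finset.range n, α k) atTop atTop)
    (hxK : ∀ k, x k ∈ K) (hzx : Tendsto (fun k => z k - x k) atTop (𝓝 0))
    (hz : ∀ k, z (k + 1) = z k + α k • u k)
    (hu : Tendsto (fun k => u k - gradient J (x k)) atTop (𝓝 0)) :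
    ∃ p, Tendsto z atTop (𝓝 p) ∧ gradient J p = 0 := by
  set F := gradient J with hFdef
  have hF : Continuous F := by
    have : F = fun y => (InnerProductSpace.toDual ℝ _).symm (fderiv ℝ J y) := rfl
    rw [this]
    exact (LinearIsometryEquiv.continuous _).comp (hJ.continuous_fderiv one_ne_zero)
  have hJc : Continuous J := hJ.continuous
  obtain ⟨R, hxD, hzD⟩ : ∃ R, (∀ k, x k ∈ Metric.closedBall 0 R) ∧
      ∀ k, z k ∈ Metric.closedBall 0 R := by
    obtain ⟨R1, hR1⟩ := hK.isBounded.exists_norm_le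
    obtain ⟨R2, hR2⟩ := (Metric.isBounded_range_of_tendsto _ hzx).exists_norm_le
    have hR2' : ∀ k, ‖z k - x k‖ ≤ R2 := fun k => hR2 _ ⟨k, rfl⟩
    have h0 : 0 ≤ R2 := (norm_nonneg _).trans (hR2' 0)
    refine ⟨R1 + R2, fun k => ?_, fun k => ?_⟩
    · rw [mem_closedBall_zero_iff]; linarith [hR1 _ (hxK k)]
    · rw [mem_closedBall_zero_iff]
      have : ‖z k‖ ≤ ‖x k‖ + ‖z k - x k‖ := by
        simpa using norm_add_le (x k) (z k - x k)
      linarith [hR1 _ (hxK k), hR2' k]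
  set D := Metric.closedBall (0 : EuclideanSpace ℝ (Fin d)) R with hDdef
  have hD : IsCompact D := isCompact_closedBall _ _
  have hFzx := rm_uc F hF D hD z x hzD hxD hzx
  have hw : Tendsto (fun k => u k - F (z k)) atTop (𝓝 0) := by
    have := hu.sub hFzx
    simpa using this
  obtain ⟨A, hA⟩ : ∃ A, ∀ k, ‖F (z k)‖ ≤ A := by
    obtain ⟨A, hA⟩ := hD.exists_bound_of_continuousOn hF.continuousOn
    exact ⟨A, fun k => hA _ (hzD k)⟩
  obtain ⟨C, hC0, hC⟩ : ∃ C > 0, ∀ k, ‖u k‖ ≤ C := by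
    obtain ⟨R2, hR2⟩ := (Metric.isBounded_range_of_tendsto _ hw).exists_norm_le
    have hR2' : ∀ k, ‖u k - F (z k)‖ ≤ R2 := fun k => hR2 _ ⟨k, rfl⟩
    refine ⟨|A| + |R2| + 1, by positivity, fun k => ?_⟩
    have : ‖u k‖ ≤ ‖F (z k)‖ + ‖u k - F (z k)‖ := by
      simpa using norm_add_le (F (z k)) (u k - F (z k))
    linarith [hA k, hR2' k, le_abs_self A, le_abs_self R2]
  have hA0 : 0 ≤ A := (norm_nonneg _).trans (hA 0)
  have hstep : ∀ k, ‖z (k+1) - z k‖ ≤ C * α k := by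
    intro k
    rw [hz k, add_sub_cancel_left, norm_smul, Real.norm_eq_abs, abs_of_nonneg (hα k), mul_comm]
    exact mul_le_mul_of_nonneg_right (hC k) (hα k)
  have hinc : Tendsto (fun k => z (k+1) - z k) atTop (𝓝 0) := by
    refine squeeze_zero_norm hstep ?_
    simpa using hαt.const_mul C
  have hJinc := rm_uc J hJc D hD (fun k => z (k+1)) z (fun k => hzD _) hzD hinc
  have key : ∀ ε > 0, ∀ᶠ k in atTop, α k * (‖F (z k)‖ ^ 2 - ε) ≤ J (z (k+1)) - J (z k) := by
    intro ε hε
    obtain ⟨η, hη, H⟩ := rm_taylor J hJ R (ε / (2 * C)) (by positivity)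
    have e1 : ∀ᶠ k in atTop, dist (z (k+1) - z k) 0 < η :=
      hinc.eventually (Metric.ball_mem_nhds _ hη)
    have e2 : ∀ᶠ k in atTop, dist (u k - F (z k)) 0 < ε / (2 * (A + 1)) :=
      hw.eventually (Metric.ball_mem_nhds _ (by positivity))
    filter_upwards [e1, e2] with k h1 h2
    rw [dist_zero_right] at h1 h2
    rw [← dist_eq_norm] at h1
    have h3 := (abs_le.1 (H _ (hzD k) _ (hzD (k+1)) h1)).1
    have h4 : ε / (2 * C) * ‖z (k+1) - z k‖ ≤ α k * (ε / 2) := by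
      calc ε / (2 * C) * ‖z (k+1) - z k‖ ≤ ε / (2 * C) * (C * α k) := by gcongr; exact hstep k
        _ = _ := by field_simp
    have h5 : inner ℝ (F (z k)) (z (k+1) - z k) =
        α k * (‖F (z k)‖^2 + inner ℝ (F (z k)) (u k - F (z k))) := by
      rw [hz k, add_sub_cancel_left, inner_smul_right, inner_sub_right,
        real_inner_self_eq_norm_sq]
      ring
    have h6 : -(ε/2) ≤ inner ℝ (F (z k)) (u k - F (z k)) := by
      have := (abs_le.1 (abs_real_inner_le_norm (F (z k)) (u k - F (z k)))).1
      have h7 : ‖F (z k)‖ * ‖u k - F (z k)‖ ≤ (A + 1) * (ε / (2 * (A + 1))) := by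
        gcongr
        linarith [hA k]
      have h8 : (A + 1) * (ε / (2 * (A + 1))) = ε / 2 := by field_simp
      linarith
    have h9 : α k * (‖F (z k)‖^2 - ε/2) ≤
        α k * (‖F (z k)‖^2 + inner ℝ (F (z k)) (u k - F (z k))) :=
      mul_le_mul_of_nonneg_left (by linarith) (hα k)
    rw [← hFdef, h5] at h3
    nlinarith
  have hSfin : {p ∈ K | F p = 0}.Finite := by
    have hSc : IsCompact {p ∈ K | F p = 0} :=
      hK.inter_right (isClosed_eq hF continuous_const)
    refine hSc.finite ?_
    rw [isDiscrete_iff_forall_mem_exists_isOpen]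
    rintro p ⟨hpK, hp0⟩
    obtain ⟨ε, hε, h⟩ := hiso p hpK hp0
    refine ⟨Metric.ball p ε, Metric.isOpen_ball, ?_⟩
    ext q
    constructor
    · rintro ⟨h1, h2, h3⟩
      exact h q h2 h3 h1
    · rintro rfl
      exact ⟨Metric.mem_ball_self hε, hpK, hp0⟩
  have hJconv : ∃ c, Tendsto (fun k => J (z k)) atTop (𝓝 c) := by
    obtain ⟨B, hB⟩ := hD.exists_bound_of_continuousOn hJc.continuousOn
    have hB' : ∀ k, |J (z k)| ≤ B := fun k => hB _ (hzD k)
    refine tendsto_of_no_upcrossings dense_univ ?_ ?_ ?_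
    · rintro a - b - hab ⟨hfa, hfb⟩
      obtain ⟨v, ⟨hav, hvb⟩, hv⟩ := (Set.Ioo_infinite hab).exists_notMem_finite (hSfin.image J)
      have hcont : Continuous fun y => |J y - v| + ‖F y‖ := by fun_prop
      obtain ⟨y, hyK, hy⟩ := hK.exists_isMinOn ⟨x 0, hxK 0⟩ hcont.continuousOn
      have hpos : 0 < |J y - v| + ‖F y‖ := by
        by_contra hneg
        have h1 := abs_nonneg (J y - v)
        have h2 := norm_nonneg (F y)
        have h3 : |J y - v| = 0 := by linarith
        have h4 : ‖F y‖ = 0 := by linarith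
        exact hv ⟨y, ⟨hyK, norm_eq_zero.1 h4⟩, by linarith [abs_eq_zero.1 h3]⟩
      set c := |J y - v| + ‖F y‖ with hcdef
      have hd := rm_uc _ hcont D hD z x hzD hxD hzx
      have e1 := hd.eventually (Metric.ball_mem_nhds _ (half_pos hpos))
      have e2 := hJinc.eventually (Metric.ball_mem_nhds _ (show 0 < c/4 by positivity))
      have e3 := key ((c/4)^2) (by positivity)
      have e4 : ∀ᶠ k in atTop, v ≤ J (z k) → v ≤ J (z (k+1)) := by
        filter_upwards [e1, e2, e3] with k h1 h2 h3 h4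
        rw [dist_zero_right, Real.norm_eq_abs, abs_lt] at h1 h2
        have hm : c ≤ |J (x k) - v| + ‖F (x k)‖ := hy (hxK k)
        by_cases h5 : J (z k) ≤ v + c/4
        · have h6 : |J (z k) - v| ≤ c/4 := abs_le.2 ⟨by linarith, by linarith⟩
          have h7 : c/4 ≤ ‖F (z k)‖ := by linarith [h1.1]
          have h8 : (c/4)^2 ≤ ‖F (z k)‖^2 := by gcongr
          have h9 := mul_nonneg (hα k) (sub_nonneg.2 h8)
          linarith
        · linarith [h2.1]
      obtain ⟨N, hN⟩ := eventually_atTop.1 e4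
      obtain ⟨n, hn, hbn⟩ := (frequently_atTop.1 hfb) N
      obtain ⟨m, hm, ham⟩ := (frequently_atTop.1 hfa) n
      have hall : ∀ m ≥ n, v ≤ J (z m) := by
        intro m hm
        induction m, hm using Nat.le_induction with
        | base => exact hvb.le.trans hbn.le
        | succ m hm ih => exact hN m (hn.trans hm) ih
      have := hall m hm
      linarith
    · exact isBoundedUnder_of ⟨B, fun k => (abs_le.1 (hB' k)).2⟩
    · exact isBoundedUnder_of ⟨-B, fun k => (abs_le.1 (hB' k)).1⟩
  have hcl : ∀ q, MapClusterPt q atTop z → F q = 0 := by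
    intro q hq
    by_contra hq0
    have hc : 0 < ‖F q‖^2 / 2 := by
      have := norm_pos_iff.2 hq0
      positivity
    set c := ‖F q‖^2 / 2 with hcdef
    have hev : ∀ᶠ y in 𝓝 q, c < ‖F y‖^2 := by
      have : Continuous fun y => ‖F y‖^2 := by fun_prop
      exact this.continuousAt.eventually_const_lt (by rw [hcdef] at hc ⊢; linarith)
    obtain ⟨r', hr', hball⟩ := Metric.eventually_nhds_iff.1 hev
    set r := r'/2 with hr
    have hrp : 0 < r := by positivity
    obtain ⟨l, hl⟩ := hJconv
    obtain ⟨N1, hN1⟩ := Metric.cauchySeq_iff.1 hl.cauchySeq ((c/2) * r / C) (by positivity)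
    obtain ⟨N2, hN2⟩ := eventually_atTop.1 (key (c/2) (by positivity))
    rw [Metric.nhds_basis_ball.mapClusterPt_iff_frequently] at hq
    obtain ⟨n, hn, hnq⟩ := (frequently_atTop.1 (hq r hrp)) (max N1 N2)
    have hn1 : N1 ≤ n := (le_max_left _ _).trans hn
    have hn2 : N2 ≤ n := (le_max_right _ _).trans hn
    have main : ∀ j, (∑ k ∈ Finset.range j, α (n + k)) * (c/2) ≤ J (z (n+j)) - J (z n) ∧
        ‖z (n+j) - z n‖ ≤ C * ∑ k ∈ Finset.range j, α (n + k) := by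
      intro j
      induction j with
      | zero => simp
      | succ j ih =>
        obtain ⟨h1, h2⟩ := ih
        have h3 := hN1 (n+j) (by omega) n hn1
        rw [Real.dist_eq] at h3
        have h3' := (abs_lt.1 h3).2
        have h4 : ∑ k ∈ Finset.range j, α (n + k) < r / C := by
          have : (∑ k ∈ Finset.range j, α (n + k)) * (c/2) < (r / C) * (c/2) := by
            calc _ < c/2 * r / C := by linarith
              _ = _ := by ring
          exact lt_of_mul_lt_mul_right this (by positivity)
        have h5 : ‖z (n+j) - z n‖ < r := by
          calc _ ≤ _ := h2
            _ < C * (r / C) := by gcongr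
            _ = r := by field_simp
        have h6 : dist (z (n+j)) q < r' := by
          rw [← dist_eq_norm] at h5
          have := dist_triangle (z (n+j)) (z n) q
          have h7 : dist (z n) q < r := hnq
          linarith
        have h7 := hball h6
        have h8 := hN2 (n+j) (by omega)
        have h9 : α (n+j) * (c/2) ≤ α (n+j) * (‖F (z (n+j))‖^2 - c/2) :=
          mul_le_mul_of_nonneg_left (by linarith) (hα _)
        rw [Finset.sum_range_succ]
        constructor
        · rw [← add_assoc]; linarith
        · have h10 := hstep (n+j)
          have h11 : ‖z (n+j+1) - z n‖ ≤ ‖z (n+j+1) - z (n+j)‖ + ‖z (n+j) - z n‖ := by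
            simpa using norm_add_le (z (n+j+1) - z (n+j)) (z (n+j) - z n)
          rw [← add_assoc]; linarith
    have hbd : ∀ j, ∑ k ∈ Finset.range j, α (n + k) < r / C := by
      intro j
      have h3 := hN1 (n+j) (by omega) n hn1
      rw [Real.dist_eq] at h3
      have h3' := (abs_lt.1 h3).2
      have : (∑ k ∈ Finset.range j, α (n + k)) * (c/2) < (r / C) * (c/2) := by
        calc _ < c/2 * r / C := by linarith [(main j).1]
          _ = _ := by ring
      exact lt_of_mul_lt_mul_right this (by positivity)
    obtain ⟨m, hmn, hm⟩ := (((tendsto_atTop.1 hαdiv) (r / C + ∑ k ∈ Finset.range n, α k)).and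
      (eventually_ge_atTop n)).exists
    obtain ⟨j, rfl⟩ := Nat.exists_eq_add_of_le hm
    rw [Finset.sum_range_add] at hmn
    linarith [hbd j]
  have hclK : ∀ q, MapClusterPt q atTop z → q ∈ K := by
    intro q hq
    have h1 : MapClusterPt q atTop x := rm_cluster x z q (by simpa using hzx.neg) hq
    exact hK.isClosed.mem_of_mapClusterPt h1 (Eventually.of_forall hxK)
  obtain ⟨p, hpK, hpx⟩ := hK.exists_mapClusterPt (f := atTop) (u := x) (by
    rw [le_principal_iff]; exact Filter.mem_map.2 (Eventually.of_forall hxK))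
  have hpz := rm_cluster z x p hzx hpx
  have hp0 := hcl p hpz
  refine ⟨p, ?_, hp0⟩
  obtain ⟨ε, hε, hi⟩ := hiso p hpK hp0
  rw [Metric.tendsto_atTop]
  intro ρ0 hρ0
  set ρ := min (ρ0/2) (ε/2) with hρdef
  have hρ : 0 < ρ := by positivity
  have hT : IsCompact (Metric.closedBall p ρ \ Metric.ball p (ρ/2)) :=
    (isCompact_closedBall _ _).diff Metric.isOpen_ball
  have hnT : ∀ᶠ k in atTop, z k ∉ Metric.closedBall p ρ \ Metric.ball p (ρ/2) := by
    rw [← not_frequently]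
    intro hf
    obtain ⟨q, hqT, hq⟩ := hT.exists_mapClusterPt_of_frequently hf
    have hqp : dist q p ≤ ρ := hqT.1
    have := hi q (hclK q hq) (hcl q hq) (by linarith [min_le_right (ρ0/2) (ε/2)])
    subst this
    exact hqT.2 (Metric.mem_ball_self (by positivity))
  have e2 := hinc.eventually (Metric.ball_mem_nhds _ (half_pos hρ))
  obtain ⟨N, hN⟩ := eventually_atTop.1 (hnT.and e2)
  rw [Metric.nhds_basis_ball.mapClusterPt_iff_frequently] at hpz
  obtain ⟨n, hn, hnp⟩ := (frequently_atTop.1 (hpz (ρ/2) (by positivity))) N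
  have hstay : ∀ m ≥ n, dist (z m) p < ρ/2 := by
    intro m hm
    induction m, hm using Nat.le_induction with
    | base => exact hnp
    | succ m hm ih =>
      have h1 := (hN m (by omega)).2
      have h2 := (hN (m+1) (by omega)).1
      rw [dist_zero_right, ← dist_eq_norm] at h1
      have h3 := dist_triangle (z (m+1)) (z m) p
      by_contra hcon
      exact h2 ⟨by rw [Metric.mem_closedBall]; linarith, hcon⟩
  refine ⟨n, fun m hm => ?_⟩
  linarith [hstay m hm, min_le_left (ρ0/2) (ε/2)]

/-- Baseline Robbins–Monro convergence (Theorem: baseline objective `J`).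
For a C¹ objective `J` on `ℝ^d` with Lipschitz gradient on a compact set `K`,
adapted iterates `x_{k+1} = x_k + α_k g_k` whose gradient estimates are
conditionally unbiased up to a vanishing deterministic bias `b_k → 0` and have
conditionally bounded second moments, with Robbins–Monro step sizes
(`Σα_k = ∞`, `Σα_k² < ∞`), iterates a.s. staying in `K`, and isolated
stationary points of `J` in `K`, the iterates converge a.s. to a stationary
point of `J`. -/
theorem stmt0 {d : ℕ}
    (J : EuclideanSpace ℝ (Fin d) → ℝ)
    (K : Set (EuclideanSpace ℝ (Fin d))) (hK : IsCompact K)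
    (hJ : ContDiff ℝ 1 J) (LJ : ℝ)
    (hLip : ∀ p ∈ K, ∀ q ∈ K, ‖gradient J p - gradient J q‖ ≤ LJ * ‖p - q‖)
    {Ω : Type*} {m0 : MeasurableSpace Ω} {μ : Measure Ω} [IsProbabilityMeasure μ]
    (ℱ : Filtration ℕ m0)
    (x g δ : ℕ → Ω → EuclideanSpace ℝ (Fin d))
    (hx : Adapted ℱ x)
    (hg : ∀ k, StronglyMeasurable[ℱ (k + 1)] (g k))
    (α : ℕ → ℝ) (hα : ∀ k, 0 ≤ α k)
    (hupd : ∀ k ω, x (k + 1) ω = x k ω + α k • g k ω)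
    (b : ℕ → ℝ)
    (hbias : ∀ k, μ[g k | ℱ k] =ᵐ[μ] fun ω => gradient J (x k ω) + δ k ω)
    (hδ : ∀ k ω, ‖δ k ω‖ ≤ b k)
    (hb : Tendsto b atTop (𝓝 0))
    (B : ℝ) (hB : 0 < B)
    (hvar : ∀ k, ∀ᵐ ω ∂μ, (μ[fun ω' => ‖g k ω'‖ ^ 2 | ℱ k]) ω ≤ B)
    (hαdiv : Tendsto (fun n => ∑ k ∈ Finset.range n, α k) atTop atTop)
    (hαsq : Summable fun k => (α k) ^ 2)
    (hmem : ∀ᵐ ω ∂μ, ∀ k, x k ω ∈ K)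
    (hiso : ∀ p ∈ K, gradient J p = 0 →
      ∃ ε > 0, ∀ q ∈ K, gradient J q = 0 → dist q p < ε → q = p) :
    ∀ᵐ ω ∂μ, ∃ xlim : EuclideanSpace ℝ (Fin d),
      Tendsto (fun k => x k ω) atTop (𝓝 xlim) ∧ gradient J xlim = 0 := by
  obtain ⟨R, hR⟩ := hK.isBounded.exists_norm_le
  have hR0 : 0 ≤ |R| := abs_nonneg R
  let Δ : ℕ → Ω → EuclideanSpace ℝ (Fin d) := fun k => α k • g k
  have hΔ : ∀ k ω, Δ k ω = x (k+1) ω - x k ω := by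
    intro k ω
    rw [hupd k ω]; simp [Δ]
  have hΔb : ∀ k, ∀ᵐ ω ∂μ, ‖Δ k ω‖ ≤ 2 * |R| := by
    intro k
    filter_upwards [hmem] with ω h
    rw [hΔ]
    have := norm_sub_le (x (k+1) ω) (x k ω)
    linarith [hR _ (h k), hR _ (h (k+1)), le_abs_self R]
  have hΔm : ∀ k, StronglyMeasurable[ℱ (k+1)] (Δ k) := fun k => (hg k).const_smul (α k)
  have hΔi : ∀ k, Integrable (Δ k) μ := fun k =>
    Integrable.of_bound ((hΔm k).mono (ℱ.le _)).aestronglyMeasurable _ (hΔb k)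
  have hΔc : ∀ k, μ[Δ k | ℱ k] =ᵐ[μ] fun ω => α k • (gradient J (x k ω) + δ k ω) := by
    intro k
    filter_upwards [condExp_smul (μ := μ) (α k) (g k) (ℱ k), hbias k] with ω h1 h2
    simp only [Δ]
    rw [h1, Pi.smul_apply, h2]
  have hΔ2i : ∀ k, Integrable (fun ω => ‖Δ k ω‖^2) μ := by
    intro k
    refine Integrable.of_bound ((hΔi k).1.norm.pow 2) ((2*|R|)^2) ?_
    filter_upwards [hΔb k] with ω h
    simp only [Pi.pow_apply, norm_pow, norm_norm]
    gcongr
  have hΔ2 : ∀ k, ∫ ω, ‖Δ k ω‖^2 ∂μ ≤ (α k)^2 * B := by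
    intro k
    have e : (fun ω => ‖Δ k ω‖^2) = (α k)^2 • (fun ω => ‖g k ω‖^2) := by
      ext ω
      simp [Δ, norm_smul, mul_pow]
    rw [e, ← integral_condExp (ℱ.le k)]
    calc _ ≤ ∫ _, (α k)^2 * B ∂μ := by
          refine integral_mono_ae integrable_condExp (integrable_const _) ?_
          filter_upwards [condExp_smul (μ := μ) ((α k)^2) (fun ω => ‖g k ω‖^2) (ℱ k), hvar k]
            with ω h1 h2
          rw [h1, Pi.smul_apply, smul_eq_mul]
          gcongr
      _ = _ := by simp
  have hconv : ∀ i : Fin d, ∀ᵐ ω ∂μ, ∃ c, Tendsto (fun n => ∑ k ∈ Finset.range n,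
      ((Δ k ω) i - (α k • (gradient J (x k ω) + δ k ω)) i)) atTop (𝓝 c) := by
    intro i
    let T : EuclideanSpace ℝ (Fin d) →L[ℝ] ℝ := EuclideanSpace.proj i
    have hle : ∀ y : EuclideanSpace ℝ (Fin d), |y i| ≤ ‖y‖ := fun y => by
      simpa using PiLp.norm_apply_le y i
    have h := rm_scalar (μ := μ) ℱ (fun k ω => (Δ k ω) i)
      (fun k => T.continuous.comp_stronglyMeasurable (hΔm k)) (2 * |R|).toNNReal
      (fun k => by
        filter_upwards [hΔb k] with ω h
        rw [Real.coe_toNNReal _ (by positivity)]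
        exact (hle _).trans h) (fun k => (α k)^2 * B) (hαsq.mul_right B)
      (fun k => by
        refine le_trans (integral_mono_of_nonneg (Eventually.of_forall fun ω => sq_nonneg _)
          (hΔ2i k) (Eventually.of_forall fun ω => ?_)) (hΔ2 k)
        simp only
        rw [← sq_abs]
        gcongr
        exact hle _)
    have hc : ∀ k, μ[fun ω => (Δ k ω) i | ℱ k] =ᵐ[μ]
        fun ω => (α k • (gradient J (x k ω) + δ k ω)) i := by
      intro k
      filter_upwards [T.comp_condExp_comm (hΔi k) (m := ℱ k), hΔc k] with ω h1 h2
      have h3 : T (μ[Δ k | ℱ k] ω) = μ[fun ω => (Δ k ω) i | ℱ k] ω := h1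
      rw [← h3, h2]
      rfl
    filter_upwards [h, ae_all_iff.2 hc] with ω ⟨c, h1⟩ h2
    refine ⟨c, ?_⟩
    simpa only [h2] using h1
  filter_upwards [ae_all_iff.2 hconv, hmem] with ω h1 hK'
  choose c hc using h1
  let N : ℕ → EuclideanSpace ℝ (Fin d) := fun n => ∑ k ∈ Finset.range n,
    (Δ k ω - α k • (gradient J (x k ω) + δ k ω))
  have hN : Tendsto N atTop (𝓝 (WithLp.toLp 2 c)) := by
    have : Tendsto (fun n => WithLp.toLp 2 (fun i => N n i)) atTop (𝓝 (WithLp.toLp 2 c)) := by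
      refine ((PiLp.continuous_toLp 2 _).tendsto c).comp (tendsto_pi_nhds.2 fun i => ?_)
      refine (hc i).congr fun n => ?_
      simp [N]
    exact this
  have hαt : Tendsto α atTop (𝓝 0) := by
    have := hαsq.tendsto_atTop_zero.sqrt
    simpa [Real.sqrt_sq (hα _)] using this
  have hδt : Tendsto (fun k => δ k ω) atTop (𝓝 0) := squeeze_zero_norm (fun k => hδ k ω) hb
  have hzx : Tendsto (fun k => (x k ω - N k + WithLp.toLp 2 c) - x k ω) atTop (𝓝 0) := by
    have := (tendsto_const_nhds (x := WithLp.toLp 2 c)).sub hN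
    rw [sub_self] at this
    refine this.congr fun k => ?_
    abel
  obtain ⟨p, hp, hp0⟩ := rm_det J K hK hJ hiso (fun k => x k ω)
    (fun k => x k ω - N k + WithLp.toLp 2 c) (fun k => gradient J (x k ω) + δ k ω) α hα hαt hαdiv
    hK' hzx (fun k => by
      have : N (k+1) = N k + (Δ k ω - α k • (gradient J (x k ω) + δ k ω)) :=
        Finset.sum_range_succ _ _
      rw [this, hΔ]
      abel) (by simpa using hδt)
  refine ⟨p, ?_, hp0⟩
  have := hp.sub hzx
  simpa using this
end

section
/- Let d ∈ ℕ and let J, L : ℝ^d → ℝ be continuously differentiable with globally Lipschitz gradients ∇J and ∇L on a compact set K ⊆ ℝ^d, and set J̃ = J − L. On a probability space with a filtration (F_k)_{k∈ℕ}, let (x_k) be adapted iterates defined by x_{k+1} = x_k + α_k f_k with f_k = g_k − h_k, where g_k, h_k are F_{k+1}-measurable with E[g_k | F_k] = ∇J(x_k) + δ_k and E[h_k | F_k] = ∇L(x_k) + δ'_k for deterministic bias bounds ‖δ_k‖ ≤ b_k, ‖δ'_k‖ ≤ b'_k with b_k → 0 and b'_k → 0, and E[‖f_k‖² | F_k] ≤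 B' almost surely for a constant B' > 0. Assume α_k ≥ 0, Σ_k α_k = ∞, Σ_k α_k² < ∞, that almost surely x_k ∈ K for all k, and that the points of K where ∇J̃ vanishes are isolated. Then almost surely (x_k) converges to a (random) limit x† satisfying ∇J̃(x†) = ∇J(x†) − ∇L(x†) = 0. -/
open MeasureTheory Filter Topology

theorem sa_cross (u : ℕ → ℝ) (a b : ℝ) (hab : a < b)
    (hinc : Tendsto (fun k => u (k+1) - u k) atTop (𝓝 0))
    (hup : ∀ᶠ k in atTop, a ≤ u k → u k ≤ b → u k ≤ u (k+1))
    (hfreq : ∃ᶠ k in atTop, b < u k) : ∀ᶠ k in atTop, a < u k := by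
  have h1 : ∀ᶠ k in atTop, |u (k+1) - u k| < (b-a)/2 := by
    have := (Metric.tendsto_nhds.1 hinc) ((b-a)/2) (by linarith)
    simpa [Real.dist_eq] using this
  obtain ⟨N, hN⟩ := eventually_atTop.1 (h1.and hup)
  obtain ⟨n, hn, hbn⟩ := (frequently_atTop.1 hfreq) N
  have key : ∀ m, n ≤ m → (a+b)/2 ≤ u m := by
    intro m hm
    induction m, hm using Nat.le_induction with
    | base => linarith
    | succ m hm ih =>
      obtain ⟨h2, h3⟩ := hN m (le_trans hn hm)
      rcases le_or_gt (u m) b with h | h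
      · have := h3 (by linarith) h
        linarith
      · have := abs_lt.1 h2
        linarith
  filter_upwards [eventually_ge_atTop n] with m hm
  have := key m hm
  linarith

theorem sa_unif {E F : Type*} [PseudoMetricSpace E] [PseudoMetricSpace F] {B : Set E}
    (hB : IsCompact B) {f : E → F} (hf : Continuous f) (a c : ℕ → E)
    (ha : ∀ k, a k ∈ B) (hc : ∀ k, c k ∈ B)
    (h : Tendsto (fun k => dist (a k) (c k)) atTop (𝓝 0)) :
    Tendsto (fun k => dist (f (a k)) (f (c k))) atTop (𝓝 0) := by
  have hu := hB.uniformContinuousOn_of_continuous hf.continuousOn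
  rw [Metric.uniformContinuousOn_iff] at hu
  rw [Metric.tendsto_atTop] at h ⊢
  intro ε hε
  obtain ⟨δ, hδ, hu⟩ := hu ε hε
  obtain ⟨N, hN⟩ := h δ hδ
  refine ⟨N, fun n hn => ?_⟩
  have h1 := hN n hn
  simp only [Real.dist_eq, sub_zero, abs_of_nonneg dist_nonneg] at h1 ⊢
  exact hu _ (ha n) _ (hc n) h1

section
variable {E : Type*} [NormedAddCommGroup E] [InnerProductSpace ℝ E] [FiniteDimensional ℝ E]
  [CompleteSpace E]

theorem sa_taylor (V : E → ℝ) (G : E → E) (hV : ∀ z, HasGradientAt V (G z) z)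
    (p q g : E) (η : ℝ) (h : ∀ z ∈ segment ℝ p q, ‖G z - g‖ ≤ η) :
    |V q - V p - inner ℝ g (q - p)| ≤ η * ‖q - p‖ := by
  have := (convex_segment (𝕜 := ℝ) p q).norm_image_sub_le_of_norm_hasFDerivWithin_le'
    (f := V) (f' := fun z => (InnerProductSpace.toDual ℝ E) (G z))
    (φ := (InnerProductSpace.toDual ℝ E) g) (C := η)
    (fun z _ => (hV z).hasFDerivAt.hasFDerivWithinAt)
    (fun z hz => by
      rw [← map_sub, LinearIsometryEquiv.norm_map]; exact h z hz)
    (left_mem_segment ℝ p q) (right_mem_segment ℝ p q)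
  simpa [Real.norm_eq_abs] using this

theorem sa_det (V : E → ℝ) (G : E → E) (hV : ∀ z, HasGradientAt V (G z) z) (hG : Continuous G)
    (K : Set E) (hK : IsCompact K) (x y : ℕ → E) (hx : ∀ k, x k ∈ K)
    (hxy : Tendsto (fun k => x k - y k) atTop (𝓝 0))
    (α : ℕ → ℝ) (hα : ∀ k, 0 ≤ α k) (hα0 : Tendsto α atTop (𝓝 0))
    (hαdiv : Tendsto (fun n => ∑ k ∈ Finset.range n, α k) atTop atTop)
    (C : ℝ) (hC : 0 < C) (hinc : ∀ k, ‖y (k+1) - y k‖ ≤ C * α k)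
    (ε : ℕ → ℝ) (hε : Tendsto ε atTop (𝓝 0))
    (hdrift : ∀ k, α k * (‖G (x k)‖ ^ 2 - ε k) ≤ inner ℝ (G (x k)) (y (k+1) - y k))
    (hiso : ∀ p ∈ K, G p = 0 → ∃ ε > 0, ∀ q ∈ K, G q = 0 → dist q p < ε → q = p) :
    ∃ p, Tendsto x atTop (𝓝 p) ∧ G p = 0 := by
  have hVc : Continuous V := continuous_iff_continuousAt.2 fun z => (hV z).continuousAt
  have hdist : Tendsto (fun k => dist (x k) (y k)) atTop (𝓝 0) := by
    simpa [dist_eq_norm] using hxy.norm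
  -- bounded region
  obtain ⟨B, hB, hBconv, hxB, hyB⟩ : ∃ B : Set E, IsCompact B ∧ Convex ℝ B ∧ (∀ k, x k ∈ B) ∧
      (∀ k, y k ∈ B) := by
    obtain ⟨R, hR⟩ := hK.isBounded.subset_closedBall 0
    obtain ⟨S, hS⟩ := (Metric.isBounded_range_of_tendsto _ hxy).subset_closedBall 0
    have h1 : ∀ k, ‖x k‖ ≤ R := fun k => by simpa using hR (hx k)
    have h2 : ∀ k, ‖x k - y k‖ ≤ S := fun k => by simpa using hS ⟨k, rfl⟩
    have hS0 : 0 ≤ S := (norm_nonneg _).trans (h2 0)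
    refine ⟨Metric.closedBall 0 (R + S), isCompact_closedBall _ _, convex_closedBall _ _,
      fun k => ?_, fun k => ?_⟩
    · simp; linarith [h1 k]
    · simp
      have : y k = x k - (x k - y k) := by abel
      rw [this]
      exact (norm_sub_le _ _).trans (add_le_add (h1 k) (h2 k))
  have hstep : Tendsto (fun k => dist (y (k+1)) (y k)) atTop (𝓝 0) := by
    refine squeeze_zero (fun _ => dist_nonneg) (fun k => ?_) (by simpa using hα0.const_mul C)
    rw [dist_eq_norm]; exact hinc k
  -- step 1
  have h1 : ∀ η > 0, ∀ᶠ k in atTop, α k * (‖G (x k)‖ ^ 2 - η) ≤ V (y (k+1)) - V (y k) := by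
    intro η hη
    have hu := hB.uniformContinuousOn_of_continuous hG.continuousOn
    rw [Metric.uniformContinuousOn_iff] at hu
    obtain ⟨δ, hδ, hu⟩ := hu (η / (2 * C)) (by positivity)
    have e1 := hdist.eventually (gt_mem_nhds (show (0:ℝ) < δ/2 by linarith))
    have e2 := hstep.eventually (gt_mem_nhds (show (0:ℝ) < δ/2 by linarith))
    have e3 := hε.eventually (gt_mem_nhds (show (0:ℝ) < η/2 by linarith))
    filter_upwards [e1, e2, e3] with k k1 k2 k3
    have ht := sa_taylor V G hV (y k) (y (k+1)) (G (x k)) (η / (2*C)) (fun z hz => by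
      have hzB : z ∈ B := hBconv.segment_subset (hyB k) (hyB (k+1)) hz
      have hzd : dist z (y k) ≤ dist (y (k+1)) (y k) := by
        have := norm_sub_le_of_mem_segment hz
        simpa [dist_eq_norm] using this
      rw [← dist_eq_norm]
      refine (hu z hzB (x k) (hxB k) ?_).le
      have := dist_triangle z (y k) (x k)
      rw [dist_comm (y k) (x k)] at this
      linarith)
    have h3 : η / (2*C) * ‖y (k+1) - y k‖ ≤ η/2 * α k := by
      calc _ ≤ η / (2*C) * (C * α k) := by gcongr; exact hinc k
        _ = _ := by field_simp
    have h4 := (abs_le.1 ht).1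
    have h5 := hdrift k
    have h6 := hα k
    nlinarith
  have h2 : Tendsto (fun k => V (y (k+1)) - V (y k)) atTop (𝓝 0) := by
    have := sa_unif hB hVc (fun k => y (k+1)) y (fun k => hyB (k+1)) hyB hstep
    rw [tendsto_zero_iff_norm_tendsto_zero]
    simpa [Real.dist_eq] using this
  have hVxy : Tendsto (fun k => dist (V (x k)) (V (y k))) atTop (𝓝 0) :=
    sa_unif hB hVc x y hxB hyB hdist
  -- the stationary set
  have hSfin : {p | p ∈ K ∧ G p = 0}.Finite := by
    have hc : IsCompact {p | p ∈ K ∧ G p = 0} :=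
      hK.inter_right (isClosed_singleton.preimage hG (t := {0}))
    refine hc.finite ?_
    rw [isDiscrete_iff_forall_mem_exists_isOpen]
    rintro p ⟨hpK, hp0⟩
    obtain ⟨ρ, hρ, hp⟩ := hiso p hpK hp0
    refine ⟨Metric.ball p ρ, Metric.isOpen_ball, ?_⟩
    ext q
    constructor
    · rintro ⟨hq1, hq2, hq3⟩
      exact hp q hq2 hq3 hq1
    · rintro rfl
      exact ⟨Metric.mem_ball_self hρ, hpK, hp0⟩
  have hVlim : ∃ ℓ, Tendsto (fun k => V (y k)) atTop (𝓝 ℓ) := by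
    have hbd : Bornology.IsBounded (Set.range fun k => V (y k)) := by
      refine (hB.image hVc).isBounded.subset ?_
      rintro _ ⟨k, rfl⟩; exact ⟨_, hyB k, rfl⟩
    have hbb := isBounded_iff_bddBelow_bddAbove.1 hbd
    refine tendsto_of_no_upcrossings (s := Set.univ) dense_univ ?_ ?_ ?_
    · rintro a - b - hab ⟨hfa, hfb⟩
      have hfin := hSfin.image V
      have hopen : IsOpen (Set.Ioo a b \ (V '' {p | p ∈ K ∧ G p = 0})) :=
        isOpen_Ioo.sdiff hfin.isClosed
      obtain ⟨w, hw⟩ : (Set.Ioo a b \ (V '' {p | p ∈ K ∧ G p = 0})).Nonempty :=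
        ((Set.Ioo_infinite hab).sdiff hfin).nonempty
      obtain ⟨τ, hτ, hball⟩ := Metric.isOpen_iff.1 hopen w hw
      -- gradient bounded below on the band
      obtain ⟨η, hη, hband⟩ : ∃ η > 0, ∀ p ∈ K, |V p - w| ≤ τ/2 → η ≤ ‖G p‖^2 := by
        have hc : IsCompact (K ∩ {p | |V p - w| ≤ τ/2}) :=
          hK.inter_right (isClosed_le (by fun_prop) continuous_const)
        rcases (K ∩ {p | |V p - w| ≤ τ/2}).eq_empty_or_nonempty with he | hne
        · refine ⟨1, one_pos, fun p hp hp2 => ?_⟩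
          exact absurd (show p ∈ K ∩ {p | |V p - w| ≤ τ/2} from ⟨hp, hp2⟩) (by simp [he])
        · obtain ⟨p0, hp0, hmin⟩ := hc.exists_isMinOn hne
            (f := fun p => ‖G p‖^2) (by fun_prop)
          refine ⟨‖G p0‖^2, ?_, fun p hp hp2 => hmin ⟨hp, hp2⟩⟩
          have : G p0 ≠ 0 := by
            intro h0
            have hm : V p0 ∈ Metric.ball w τ := by
              rw [Metric.mem_ball, Real.dist_eq]
              have := hp0.2
              simp only [Set.mem_ofPred_eq] at this
              linarith
            exact (hball hm).2 ⟨p0, ⟨hp0.1, h0⟩, rfl⟩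
          positivity
      have hwab := hw.1
      have hlo : a ≤ w - τ/4 := by
        have hm : w - τ/4 ∈ Metric.ball w τ := by
          rw [Metric.mem_ball, Real.dist_eq, abs_lt]; constructor <;> linarith
        exact (hball hm).1.1.le
      have hhi : w + τ/4 ≤ b := by
        have hm : w + τ/4 ∈ Metric.ball w τ := by
          rw [Metric.mem_ball, Real.dist_eq, abs_lt]; constructor <;> linarith
        exact (hball hm).1.2.le
      have hev := sa_cross (fun k => V (y k)) (w - τ/4) (w + τ/4) (by linarith) h2 (by
        filter_upwards [h1 η hη, hVxy.eventually (gt_mem_nhds (show (0:ℝ) < τ/4 by linarith))]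
          with k k1 k2 k3 k4
        rw [Real.dist_eq, abs_lt] at k2
        have := hband (x k) (hx k) (by rw [abs_le]; constructor <;> linarith)
        have := mul_nonneg (hα k) (sub_nonneg.2 this)
        linarith) (hfb.mono fun k hk => by linarith)
      obtain ⟨k, k1, k2⟩ := (hfa.and_eventually hev).exists
      linarith
    · exact hbb.2.isBoundedUnder_of_range
    · exact hbb.1.isBoundedUnder_of_range
  obtain ⟨ℓ, hℓ⟩ := hVlim
  -- cluster points are stationary
  have hclus : ∀ q, MapClusterPt q atTop x → G q = 0 := by
    intro q hq
    by_contra hne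
    have hpos : 0 < ‖G q‖^2 := by positivity
    set η := ‖G q‖^2 / 4 with hηd
    have hη : 0 < η := by positivity
    have hcont : ∀ᶠ z in 𝓝 q, 2*η < ‖G z‖^2 :=
      (show Continuous fun z => ‖G z‖^2 by fun_prop).continuousAt.eventually
        (lt_mem_nhds (by simp only [hηd]; linarith))
    obtain ⟨r, hr, hball⟩ := Metric.eventually_nhds_iff.1 hcont
    have e1 := hdist.eventually (gt_mem_nhds (show (0:ℝ) < r/4 by linarith))
    have e2 : ∀ᶠ k in atTop, |V (y k) - ℓ| < η * r / (8 * C) := by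
      have := (Metric.tendsto_nhds.1 hℓ) (η * r / (8 * C)) (by positivity)
      simpa [Real.dist_eq] using this
    obtain ⟨N, hN⟩ := eventually_atTop.1 ((h1 η hη).and (e1.and e2))
    have hfr := hq.frequently (Metric.ball_mem_nhds q (show 0 < r/4 by linarith))
    obtain ⟨n, hn, hnq⟩ := (frequently_atTop.1 hfr) N
    have key : ∀ m, n ≤ m → ‖y m - y n‖ ≤ C * (∑ k ∈ Finset.Ico n m, α k) ∧
        η * (∑ k ∈ Finset.Ico n m, α k) ≤ V (y m) - V (y n) := by
      intro m hm
      induction m, hm using Nat.le_induction with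
      | base => simp
      | succ m hm ih =>
        obtain ⟨i1, i2⟩ := ih
        obtain ⟨j1, j2, j3⟩ := hN m (le_trans hn hm)
        obtain ⟨l1, l2, l3⟩ := hN n hn
        rw [Finset.sum_Ico_succ_top hm]
        have hs : ∑ k ∈ Finset.Ico n m, α k ≤ r / (4*C) := by
          rw [abs_lt] at j3 l3
          have : η * (∑ k ∈ Finset.Ico n m, α k) ≤ η * (r / (4*C)) := by
            have : η * (r / (4*C)) = η * r / (8 * C) + η * r / (8 * C) := by field_simp; ring
            linarith
          exact le_of_mul_le_mul_left this hη
        have hd : dist (x m) q < r := by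
          have t1 := dist_triangle4 (x m) (y m) (y n) (x n)
          have t2 := dist_triangle (x m) (x n) q
          have t3 : dist (y m) (y n) ≤ r/4 := by
            rw [dist_eq_norm]
            refine i1.trans ?_
            calc _ ≤ C * (r / (4*C)) := by gcongr
              _ = _ := by field_simp
          rw [dist_comm (y n) (x n)] at t1
          linarith
        have hg := hball hd
        constructor
        · have : y (m+1) - y n = (y (m+1) - y m) + (y m - y n) := by abel
          rw [this]
          have := norm_add_le (y (m+1) - y m) (y m - y n)
          have := hinc m
          linarith
        · have := mul_le_mul_of_nonneg_left (show η ≤ ‖G (x m)‖^2 - η by linarith) (hα m)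
          linarith
    have hbig := (tendsto_atTop.1 hαdiv) ((∑ k ∈ Finset.range n, α k) + r / C)
    obtain ⟨m, hm1, hm2⟩ := (hbig.and (eventually_ge_atTop n)).exists
    have hk := (key m hm2).2
    rw [Finset.sum_Ico_eq_sub _ hm2] at hk
    have j3 := (hN m (le_trans hn hm2)).2.2
    have l3 := (hN n hn).2.2
    rw [abs_lt] at j3 l3
    have : η * (r / C) ≤ η * (r/(4*C)) := by
      have e : η * (r / (4*C)) = η * r / (8 * C) + η * r / (8 * C) := by field_simp; ring
      have := mul_le_mul_of_nonneg_left (show r / C ≤ ∑ k ∈ Finset.range m, α k - ∑ k ∈ Finset.range n, α k by linarith) hη.le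
      linarith
    have h7 := le_of_mul_le_mul_left this hη
    have h8 : r / (4*C) = r / C / 4 := by field_simp
    have h9 : 0 < r / C := by positivity
    linarith
  -- conclusion
  obtain ⟨p, hpK, hp⟩ := hK.exists_mapClusterPt (f := atTop) (u := x)
    (by simp only [le_principal_iff, mem_map]; exact Eventually.of_forall hx)
  have hGp := hclus p hp
  refine ⟨p, ?_, hGp⟩
  obtain ⟨ρ, hρ, hisop⟩ := hiso p hpK hGp
  rw [Metric.tendsto_nhds]
  intro r0 hr0
  set r := min r0 (ρ/2) with hrd
  have hr : 0 < r := by positivity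
  have hxstep : Tendsto (fun k => dist (x (k+1)) (x k)) atTop (𝓝 0) := by
    have hh := (((tendsto_add_atTop_iff_nat 1).2 hdist).add hstep).add hdist
    simp only [add_zero] at hh
    refine squeeze_zero (fun _ => dist_nonneg) (fun k => ?_) hh
    have := dist_triangle4 (x (k+1)) (y (k+1)) (y k) (x k)
    rw [dist_comm (y k) (x k)] at this
    exact this
  have hann : ∀ᶠ k in atTop, ¬ (r/2 ≤ dist (x k) p ∧ dist (x k) p ≤ r) := by
    by_contra hcon
    have hfr : ∃ᶠ k in atTop, x k ∈ K ∩ {z | r/2 ≤ dist z p ∧ dist z p ≤ r} := by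
      rw [Filter.not_eventually] at hcon
      exact hcon.mono fun k hk => ⟨hx k, not_not.1 hk⟩
    have hc : IsCompact (K ∩ {z | r/2 ≤ dist z p ∧ dist z p ≤ r}) := by
      refine hK.inter_right ?_
      exact (isClosed_le (f := fun _ => r/2) (g := fun z => dist z p) (by fun_prop)
        (by fun_prop)).inter
        (isClosed_le (f := fun z => dist z p) (g := fun _ => r) (by fun_prop) (by fun_prop))
    obtain ⟨q, hq, hqc⟩ := hc.exists_mapClusterPt_of_frequently hfr
    have h0 := hclus q hqc
    have := hisop q hq.1 h0 (lt_of_le_of_lt hq.2.2 (lt_of_le_of_lt (min_le_right _ _) (by linarith)))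
    have h3 := hq.2.1
    rw [this, dist_self] at h3
    linarith
  have := sa_cross (fun k => - dist (x k) p) (-r) (-(r/2)) (by linarith) (by
      refine squeeze_zero_norm (fun k => ?_) hxstep
      rw [Real.norm_eq_abs]
      have := abs_dist_sub_le (x (k+1)) (x k) p
      rw [← abs_neg]
      convert this using 2
      ring) (by
      filter_upwards [hann] with k hk h5 h6
      exact absurd ⟨by linarith, by linarith⟩ hk) (by
      refine (hp.frequently (Metric.ball_mem_nhds p (show 0 < r/2 by linarith))).mono ?_
      intro k hk
      linarith)
  filter_upwards [this] with k hk
  have := min_le_left r0 (ρ/2)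
  linarith
end

theorem sa_mart {Ω : Type*} {m0 : MeasurableSpace Ω} {μ : Measure Ω} [IsProbabilityMeasure μ]
    (ℱ : Filtration ℕ m0) (u : ℕ → Ω → ℝ) (hu : StronglyAdapted ℱ u)
    (hL2 : ∀ k, MemLp (u k) 2 μ) (s : ℕ → ℝ) (hs : Summable s) (hs0 : ∀ k, 0 ≤ s k)
    (hinc : ∀ k, ∫ ω, (u (k+1) ω - u k ω) ^ 2 ∂μ ≤ s k) :
    ∀ᵐ ω ∂μ, ∃ c, Tendsto (fun n => martingalePart u ℱ μ n ω) atTop (𝓝 c) := by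
  have hinteg : ∀ k, Integrable (u k) μ := fun k => (hL2 k).integrable (by norm_num)
  have hM : Martingale (martingalePart u ℱ μ) ℱ μ := martingale_martingalePart hu hinteg
  set M := martingalePart u ℱ μ with hMd
  have hdiff : ∀ k, M (k+1) = M k + ((u (k+1) - u k) - μ[u (k+1) - u k | ℱ k]) := by
    intro k
    simp only [hMd, martingalePart, predictablePart_add_one]
    abel
  have hXL2 : ∀ k, MemLp (u (k+1) - u k) 2 μ := fun k => (hL2 (k+1)).sub (hL2 k)
  have hDL2 : ∀ k, MemLp ((u (k+1) - u k) - μ[u (k+1) - u k | ℱ k]) 2 μ := fun k =>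
    (hXL2 k).sub ((hXL2 k).condExp (by norm_num))
  have hML2 : ∀ k, MemLp (M k) 2 μ := by
    intro k
    induction k with
    | zero => simpa [hMd] using hL2 0
    | succ k ih => rw [hdiff k]; exact ih.add (hDL2 k)
  have hD : ∀ k, ∫ ω, (((u (k+1) - u k) - μ[u (k+1) - u k | ℱ k]) ω) ^ 2 ∂μ ≤ s k := by
    intro k
    have h1 : ∫ ω, (((u (k+1) - u k) - μ[u (k+1) - u k | ℱ k]) ω) ^ 2 ∂μ =
        ∫ ω, (ProbabilityTheory.condVar (ℱ k) (u (k+1) - u k) μ) ω ∂μ := by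
      rw [ProbabilityTheory.condVar, integral_condExp (ℱ.le k)]
      rfl
    rw [h1]
    refine (integral_mono_ae ProbabilityTheory.integrable_condVar integrable_condExp
      (ProbabilityTheory.condVar_ae_le_condExp_sq (ℱ.le k) (hXL2 k))).trans ?_
    rw [integral_condExp (ℱ.le k)]
    exact hinc k
  have hcross : ∀ k, ∫ ω, M k ω * ((u (k+1) - u k) - μ[u (k+1) - u k | ℱ k]) ω ∂μ = 0 := by
    intro k
    have hz : μ[(u (k+1) - u k) - μ[u (k+1) - u k | ℱ k] | ℱ k] =ᵐ[μ] 0 := by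
      have e := condExp_sub ((hXL2 k).integrable (by norm_num))
        (integrable_condExp (f := u (k+1) - u k) (m := ℱ k) (μ := μ)) (ℱ k)
      refine e.trans ?_
      rw [condExp_of_stronglyMeasurable (ℱ.le k) stronglyMeasurable_condExp integrable_condExp]
      simp
    have hp := condExp_mul_of_stronglyMeasurable_left (μ := μ) (hM.1 k)
      ((hML2 k).integrable_mul (hDL2 k)) ((hDL2 k).integrable (by norm_num))
    have : ∫ ω, M k ω * ((u (k+1) - u k) - μ[u (k+1) - u k | ℱ k]) ω ∂μ =
      ∫ ω, (μ[M k * ((u (k+1) - u k) - μ[u (k+1) - u k | ℱ k]) | ℱ k]) ω ∂μ := by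
        rw [integral_condExp (ℱ.le k)]; rfl
    rw [this]
    refine integral_eq_zero_of_ae (hp.trans ?_)
    filter_upwards [hz] with ω hω
    simp only [Pi.mul_apply, hω, Pi.zero_apply, mul_zero]
  have hsq : ∀ n, ∫ ω, (M n ω)^2 ∂μ ≤ ∫ ω, (M 0 ω)^2 ∂μ + ∑ k ∈ Finset.range n, s k := by
    intro n
    induction n with
    | zero => simp
    | succ n ih =>
      have e : ∫ ω, (M (n+1) ω)^2 ∂μ = ∫ ω, (M n ω)^2 ∂μ +
          2 * ∫ ω, M n ω * ((u (n+1) - u n) - μ[u (n+1) - u n | ℱ n]) ω ∂μ +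
          ∫ ω, (((u (n+1) - u n) - μ[u (n+1) - u n | ℱ n]) ω) ^ 2 ∂μ := by
        have i1 : Integrable (fun ω => (M n ω)^2) μ := (hML2 n).integrable_sq
        have i2 : Integrable (fun ω => M n ω * ((u (n+1) - u n) - μ[u (n+1) - u n | ℱ n]) ω) μ :=
          (hML2 n).integrable_mul (hDL2 n)
        have i3 : Integrable (fun ω => (((u (n+1) - u n) - μ[u (n+1) - u n | ℱ n]) ω) ^ 2) μ :=
          (hDL2 n).integrable_sq
        rw [← integral_const_mul, ← integral_add i1 (i2.const_mul 2),
          ← integral_add (by exact i1.add (i2.const_mul 2)) i3]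
        congr 1
        ext ω
        rw [hdiff n]
        simp only [Pi.add_apply]
        ring
      rw [e, hcross n, Finset.sum_range_succ]
      have := hD n
      linarith
  set T := ∫ ω, (M 0 ω)^2 ∂μ + ∑' k, s k with hT
  have hT' : ∀ n, ∫ ω, (M n ω)^2 ∂μ ≤ T := fun n =>
    (hsq n).trans (by
      have := hs.sum_le_tsum (Finset.range n) (fun k _ => hs0 k)
      linarith)
  have hb : ∀ n, eLpNorm (M n) 1 μ ≤ (Real.toNNReal (1 + T) : ENNReal) := by
    intro n
    rw [eLpNorm_one_eq_lintegral_enorm,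
      ← ofReal_integral_norm_eq_lintegral_enorm ((hML2 n).integrable (by norm_num))]
    refine ENNReal.ofReal_le_ofReal ?_
    have : ∫ ω, ‖M n ω‖ ∂μ ≤ ∫ ω, (1 + (M n ω)^2) ∂μ := by
      refine integral_mono ((hML2 n).integrable (by norm_num)).norm
        ((integrable_const 1).add (hML2 n).integrable_sq) fun ω => ?_
      simp only [Real.norm_eq_abs]
      rw [← sq_abs]
      nlinarith [sq_nonneg (|M n ω| - 1), abs_nonneg (M n ω)]
    rw [integral_add (integrable_const 1) (hML2 n).integrable_sq] at this
    have h2 := hT' n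
    simp only [integral_const, probReal_univ, smul_eq_mul, one_mul] at this
    linarith
  filter_upwards [hM.submartingale.ae_tendsto_limitProcess hb] with ω hω
  exact ⟨_, hω⟩

/-- Robbins–Monro convergence for the augmented objective `J̃ = J − L`
(Theorem: stationarity of `J̃`). With C¹ objectives `J` and alignment penalty
`L` having Lipschitz gradients on a compact set `K`, adapted iterates
`x_{k+1} = x_k + α_k f_k`, `f_k = g_k − h_k`, where `g_k` and `h_k` are
conditionally unbiased estimators of `∇J(x_k)` and `∇L(x_k)` up to vanishing
deterministic biases, `f_k` has conditionally bounded second moments,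
Robbins–Monro step sizes hold, the iterates a.s. stay in `K`, and the
stationary points of `J̃` in `K` are isolated, the iterates converge a.s. to a
point where `∇J̃ = ∇J − ∇L` vanishes. -/
theorem stmt1 {d : ℕ}
    (J L : EuclideanSpace ℝ (Fin d) → ℝ)
    (K : Set (EuclideanSpace ℝ (Fin d))) (hK : IsCompact K)
    (hJ : ContDiff ℝ 1 J) (hL : ContDiff ℝ 1 L) (LJ LL : ℝ)
    (hLipJ : ∀ p ∈ K, ∀ q ∈ K, ‖gradient J p - gradient J q‖ ≤ LJ * ‖p - q‖)
    (hLipL : ∀ p ∈ K, ∀ q ∈ K, ‖gradient L p - gradient L q‖ ≤ LL * ‖p - q‖)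
    {Ω : Type*} {m0 : MeasurableSpace Ω} {μ : Measure Ω} [IsProbabilityMeasure μ]
    (ℱ : Filtration ℕ m0)
    (x gk hk δ δ' : ℕ → Ω → EuclideanSpace ℝ (Fin d))
    (hx : Adapted ℱ x)
    (hgmeas : ∀ k, StronglyMeasurable[ℱ (k + 1)] (gk k))
    (hhmeas : ∀ k, StronglyMeasurable[ℱ (k + 1)] (hk k))
    (α : ℕ → ℝ) (hα : ∀ k, 0 ≤ α k)
    (hupd : ∀ k ω, x (k + 1) ω = x k ω + α k • (gk k ω - hk k ω))
    (b b' : ℕ → ℝ)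
    (hbiasg : ∀ k, μ[gk k | ℱ k] =ᵐ[μ] fun ω => gradient J (x k ω) + δ k ω)
    (hbiash : ∀ k, μ[hk k | ℱ k] =ᵐ[μ] fun ω => gradient L (x k ω) + δ' k ω)
    (hδ : ∀ k ω, ‖δ k ω‖ ≤ b k) (hδ' : ∀ k ω, ‖δ' k ω‖ ≤ b' k)
    (hb : Tendsto b atTop (𝓝 0)) (hb' : Tendsto b' atTop (𝓝 0))
    (B' : ℝ) (hB' : 0 < B')
    (hvar : ∀ k, ∀ᵐ ω ∂μ,
      (μ[fun ω' => ‖gk k ω' - hk k ω'‖ ^ 2 | ℱ k]) ω ≤ B')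
    (hαdiv : Tendsto (fun n => ∑ k ∈ Finset.range n, α k) atTop atTop)
    (hαsq : Summable fun k => (α k) ^ 2)
    (hmem : ∀ᵐ ω ∂μ, ∀ k, x k ω ∈ K)
    (hiso : ∀ p ∈ K, gradient J p - gradient L p = 0 →
      ∃ ε > 0, ∀ q ∈ K, gradient J q - gradient L q = 0 → dist q p < ε → q = p) :
    ∀ᵐ ω ∂μ, ∃ xlim : EuclideanSpace ℝ (Fin d),
      Tendsto (fun k => x k ω) atTop (𝓝 xlim) ∧
      gradient J xlim - gradient L xlim = 0 := by
  classical
  have hcg : ∀ F : EuclideanSpace ℝ (Fin d) → ℝ, ContDiff ℝ 1 F → Continuous (gradient F) := by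
    intro F hF
    exact (InnerProductSpace.toDual ℝ _).symm.continuous.comp (hF.continuous_fderiv (by norm_num))
  set G : EuclideanSpace ℝ (Fin d) → EuclideanSpace ℝ (Fin d) :=
    fun z => gradient J z - gradient L z with hGd
  have hG : Continuous G := (hcg J hJ).sub (hcg L hL)
  have hV : ∀ z, HasGradientAt (fun z => J z - L z) (G z) z := fun z =>
    by
      have h1 := (hJ.differentiable (by norm_num) z).hasGradientAt.hasFDerivAt
      have h2 := (hL.differentiable (by norm_num) z).hasGradientAt.hasFDerivAt
      have h3 := h1.sub h2
      rw [← map_sub] at h3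
      exact h3
  have hα0 : Tendsto α atTop (𝓝 0) := by
    have := (hαsq.tendsto_atTop_zero).sqrt
    simpa [Real.sqrt_sq (hα _)] using this
  -- bounds
  obtain ⟨R, hR⟩ := hK.isBounded.subset_closedBall 0
  obtain ⟨CG0, hCG0⟩ := (hK.image hG).isBounded.subset_closedBall 0
  set CG := max CG0 0 with hCGd
  have hCG : ∀ p ∈ K, ‖G p‖ ≤ CG := fun p hp =>
    le_trans (by simpa using hCG0 ⟨p, hp, rfl⟩) (le_max_left _ _)
  have hCGnn : 0 ≤ CG := le_max_right _ _
  have hxs : StronglyAdapted ℱ x := fun k => (hx k).stronglyMeasurable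
  have hxmeas : ∀ k, AEStronglyMeasurable (x k) μ := fun k =>
    ((hxs k).mono (ℱ.le k)).aestronglyMeasurable
  have hxtop : ∀ k, MemLp (x k) ⊤ μ := fun k =>
    memLp_top_of_bound (hxmeas k) R (by
      filter_upwards [hmem] with ω hω
      simpa using hR (hω k))
  have hx2 : ∀ k, MemLp (x k) 2 μ := fun k => (hxtop k).mono_exponent le_top
  have hx1 : ∀ k, Integrable (x k) μ := fun k => (hx2 k).integrable (by norm_num)
  have hd2 : ∀ k, MemLp (x (k+1) - x k) 2 μ := fun k => (hx2 (k+1)).sub (hx2 k)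
  have hd1 : ∀ k, Integrable (x (k+1) - x k) μ := fun k => (hd2 k).integrable (by norm_num)
  have hdsq : ∀ k, Integrable (fun ω => ‖(x (k+1) - x k) ω‖ ^ 2) μ := fun k =>
    (hd2 k).integrable_norm_pow (by norm_num)
  have hdeq : ∀ k, x (k+1) - x k = α k • (gk k - hk k) := by
    intro k; ext1 ω; simp [hupd k ω]
  have hcsq : ∀ k, μ[fun ω => ‖(x (k+1) - x k) ω‖ ^ 2 | ℱ k] ≤ᵐ[μ] fun _ => α k ^ 2 * B' := by
    intro k
    have e : (fun ω => ‖(x (k+1) - x k) ω‖ ^ 2) =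
        (α k ^ 2) • (fun ω' => ‖gk k ω' - hk k ω'‖ ^ 2) := by
      ext1 ω
      rw [hdeq k]
      simp [norm_smul, mul_pow]
    rw [e]
    filter_upwards [condExp_smul (μ := μ) (m := ℱ k) (α k ^ 2)
      (fun ω' => ‖gk k ω' - hk k ω'‖ ^ 2), hvar k] with ω h1 h2
    rw [h1]
    simp only [Pi.smul_apply, smul_eq_mul]
    exact mul_le_mul_of_nonneg_left h2 (sq_nonneg _)
  have hIsq : ∀ k, ∫ ω, ‖(x (k+1) - x k) ω‖ ^ 2 ∂μ ≤ α k ^ 2 * B' := by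
    intro k
    rw [← integral_condExp (ℱ.le k)]
    refine (integral_mono_ae integrable_condExp (integrable_const _) (hcsq k)).trans ?_
    simp
  set C := Real.sqrt B' with hCd
  have hC : 0 < C := Real.sqrt_pos.2 hB'
  -- predictable increments are bounded
  have hDb : ∀ k, ∀ᵐ ω ∂μ, ‖(μ[x (k+1) - x k | ℱ k]) ω‖ ≤ C * α k := by
    intro k
    have hj := Integrable.norm_condExp_rpow_le (μ := μ) (m := ℱ k) (f := x (k+1) - x k) (p := 2)
      (by norm_num) (by simpa only [Real.rpow_two] using hdsq k)
    simp only [Real.rpow_two] at hj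
    filter_upwards [hj, hcsq k] with ω h1 h2
    have h3 := h1.trans h2
    refine abs_le_of_sq_le_sq' (?_ : _ ≤ _) (mul_nonneg hC.le (hα k)) |>.2
    rw [mul_pow, Real.sq_sqrt hB'.le]
    linarith
  -- drift
  set e : ℕ → ℝ := fun k => (b k + b' k) * (CG + C) with hed
  have he : Tendsto e atTop (𝓝 0) := by
    have := (hb.add hb').mul_const (CG + C)
    simpa using this
  have hdrift : ∀ k, ∀ᵐ ω ∂μ, α k * (‖G (x k ω)‖ ^ 2 - e k) ≤
      inner ℝ (G (x k ω)) ((μ[x (k+1) - x k | ℱ k]) ω) := by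
    intro k
    rcases (hα k).eq_or_lt with h0 | hpos
    · filter_upwards [hDb k] with ω h1
      rw [← h0, mul_zero] at h1
      rw [← h0, norm_le_zero_iff.1 h1]
      simp
    have hfi : Integrable (gk k - hk k) μ := by
      have : gk k - hk k = (α k)⁻¹ • (x (k+1) - x k) := by
        rw [hdeq k, smul_smul, inv_mul_cancel₀ hpos.ne', one_smul]
      rw [this]
      exact (hd1 k).smul _
    have hsm : μ[x (k+1) - x k | ℱ k] =ᵐ[μ] α k • μ[gk k - hk k | ℱ k] := by
      rw [hdeq k]; exact condExp_smul _ _ _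
    by_cases hgi : Integrable (gk k) μ
    · have hhi : Integrable (hk k) μ := by
        have := hgi.sub hfi
        simpa using this
      filter_upwards [hsm, condExp_sub hgi hhi (ℱ k), hbiasg k, hbiash k, hmem]
        with ω h1 h2 h3 h4 h5
      rw [h1, Pi.smul_apply, inner_smul_right, h2, Pi.sub_apply, h3, h4]
      refine mul_le_mul_of_nonneg_left ?_ (hα k)
      have e1 : gradient J (x k ω) + δ k ω - (gradient L (x k ω) + δ' k ω) =
          G (x k ω) + (δ k ω - δ' k ω) := by simp only [hGd]; abel
      rw [e1, inner_add_right, real_inner_self_eq_norm_sq]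
      have e2 := (abs_le.1 (abs_real_inner_le_norm (G (x k ω)) (δ k ω - δ' k ω))).1
      have e3 : ‖δ k ω - δ' k ω‖ ≤ b k + b' k :=
        (norm_sub_le _ _).trans (add_le_add (hδ k ω) (hδ' k ω))
      have e4 : ‖G (x k ω)‖ * ‖δ k ω - δ' k ω‖ ≤ CG * (b k + b' k) :=
        mul_le_mul (hCG _ (h5 k)) e3 (norm_nonneg _) hCGnn
      have e5 : 0 ≤ b k + b' k := (norm_nonneg _).trans e3
      have e6 : 0 ≤ (b k + b' k) * C := mul_nonneg e5 hC.le
      simp only [hed]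
      linarith
    · have hhi : ¬ Integrable (hk k) μ := by
        intro hcon
        apply hgi
        have := hfi.add hcon
        simpa using this
      have hg0 := hbiasg k
      have hh0 := hbiash k
      rw [condExp_of_not_integrable hgi] at hg0
      rw [condExp_of_not_integrable hhi] at hh0
      filter_upwards [hg0, hh0, hDb k, hmem] with ω h1 h2 h3 h5
      simp only [Pi.zero_apply] at h1 h2
      have e1 : G (x k ω) = δ' k ω - δ k ω := by
        simp only [hGd]
        rw [eq_neg_of_add_eq_zero_left h1.symm, eq_neg_of_add_eq_zero_left h2.symm]
        abel
      have e3 : ‖G (x k ω)‖ ≤ b k + b' k := by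
        rw [e1]
        have := (norm_sub_le (δ' k ω) (δ k ω)).trans (add_le_add (hδ' k ω) (hδ k ω))
        linarith
      have e5 : 0 ≤ b k + b' k := (norm_nonneg _).trans e3
      have e2 := (abs_le.1 (abs_real_inner_le_norm (G (x k ω)) ((μ[x (k+1) - x k | ℱ k]) ω))).1
      have e4 : ‖G (x k ω)‖ * ‖(μ[x (k+1) - x k | ℱ k]) ω‖ ≤ (b k + b' k) * (C * α k) :=
        mul_le_mul e3 h3 (norm_nonneg _) e5
      have e6 : ‖G (x k ω)‖ ^ 2 ≤ (b k + b' k) * CG := by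
        rw [sq]
        exact mul_le_mul e3 (hCG _ (h5 k)) (norm_nonneg _) e5
      have e7 := mul_le_mul_of_nonneg_left e6 (hα k)
      simp only [hed]
      linarith
  -- convergence of the martingale part
  have hcoord : ∀ i : Fin d, ∀ᵐ ω ∂μ, ∃ c,
      Tendsto (fun n => martingalePart x ℱ μ n ω i) atTop (𝓝 c) := by
    intro i
    set P : EuclideanSpace ℝ (Fin d) →L[ℝ] ℝ := EuclideanSpace.proj i with hP
    have hm := sa_mart (μ := μ) ℱ (fun k => P ∘ x k)
      (fun k => P.continuous.comp_stronglyMeasurable (hxs k))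
      (fun k => P.comp_memLp' (hx2 k)) (fun k => α k ^ 2 * B') (hαsq.mul_right B')
      (fun k => by positivity) (fun k => by
        refine (integral_mono_of_nonneg (Eventually.of_forall fun ω => sq_nonneg _) (hdsq k)
          (Eventually.of_forall fun ω => ?_)).trans (hIsq k)
        have : ‖(x (k+1) - x k) ω i‖ ≤ ‖(x (k+1) - x k) ω‖ := PiLp.norm_apply_le _ i
        have h2 := pow_le_pow_left₀ (norm_nonneg _) this 2
        rw [Real.norm_eq_abs, sq_abs] at h2
        simpa [hP] using h2)
    have hcomm : ∀ k, P ∘ μ[x (k+1) - x k | ℱ k] =ᵐ[μ] μ[P ∘ x (k+1) - P ∘ x k | ℱ k] := by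
      intro k
      have := P.comp_condExp_comm (m := ℱ k) (hd1 k)
      have e2 : P ∘ (x (k+1) - x k) = P ∘ x (k+1) - P ∘ x k := by
        ext ω; simp
      rwa [e2] at this
    filter_upwards [hm, ae_all_iff.2 hcomm] with ω ⟨c, hc⟩ h2
    refine ⟨c, hc.congr fun n => ?_⟩
    simp only [martingalePart, predictablePart, Pi.sub_apply, Finset.sum_apply]
    have : ∀ z : EuclideanSpace ℝ (Fin d), z i = P z := fun z => rfl
    rw [this, map_sub, map_sum]
    congr 1
    refine Finset.sum_congr rfl fun k _ => ?_
    exact (h2 k).symm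
  filter_upwards [ae_all_iff.2 hcoord, ae_all_iff.2 hdrift, ae_all_iff.2 hDb, hmem]
    with ω h1 h2 h3 h4
  choose c hc using h1
  have hMlim : Tendsto (fun n => martingalePart x ℱ μ n ω) atTop (𝓝 (WithLp.toLp 2 c)) := by
    have hpi : Tendsto (fun n => (fun i => martingalePart x ℱ μ n ω i)) atTop (𝓝 c) :=
      tendsto_pi_nhds.2 hc
    exact ((PiLp.continuous_toLp 2 _).tendsto c).comp hpi
  have hyinc : ∀ k, (predictablePart x ℱ μ (k+1) ω + WithLp.toLp 2 c) -
      (predictablePart x ℱ μ k ω + WithLp.toLp 2 c) = (μ[x (k+1) - x k | ℱ k]) ω := by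
    intro k
    rw [predictablePart_add_one, Pi.add_apply]
    abel
  refine sa_det (fun z => J z - L z) G hV hG K hK (fun k => x k ω)
    (fun k => predictablePart x ℱ μ k ω + WithLp.toLp 2 c) h4 ?_ α hα hα0 hαdiv C hC
    (fun k => by rw [hyinc k]; exact h3 k) e he (fun k => by rw [hyinc k]; exact h2 k) hiso
  have := hMlim.sub_const (WithLp.toLp 2 c)
  rw [sub_self] at this
  refine this.congr fun n => ?_
  simp only [martingalePart, Pi.sub_apply]
  abel
end
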